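/- arXiv:1612.04624 — 8 statements merged into one kernel-verified Lean document; each statement's English description precedes it below -/
import Mathlib

section
/- Let d ≥ 1 and let g : Fin d → ℝ be a family of real numbers, not all zero, and set S := Σ_q g_q². Define the complex numbers α_c := g_c · (Real.sqrt(1 + 4S) − 1) / (2 · i · S) for c = 1,…,d. Then for every c one has α_c · (1 + i · Σ_q g_q α_q) = − i · g_c. Moreover each α_c² is a nonpositive real number, so 1 − α_c² is a real number ≥ 1. -/
open Complex

/-- The saddle-point values `α_c` of the Hubbard–Stratonovich matrices of the quartic
melonic tensor model satisfy the extremum condition `α_c (1 + i Σ_q g_q α_q) = - i g_c`,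
each `α_c ^ 2` is a nonpositive real, and `1 - α_c ^ 2` is a real number `≥ 1`. -/
theorem quartic_melonic_saddle_point
    (d : ℕ) (hd : 1 ≤ d) (g : Fin d → ℝ) (hg : g ≠ 0)
    (S : ℝ) (hS : S = ∑ q, (g q) ^ 2)
    (α : Fin d → ℂ)
    (hα : ∀ c, α c =
      (g c : ℂ) * (((Real.sqrt (1 + 4 * S) - 1 : ℝ)) : ℂ) / (2 * Complex.I * (S : ℂ))) :
    (∀ c, α c * (1 + Complex.I * ∑ q, (g q : ℂ) * α q) = - Complex.I * (g c : ℂ)) ∧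
    (∀ c, ∃ r : ℝ, r ≤ 0 ∧ (α c) ^ 2 = (r : ℂ)) ∧
    (∀ c, ∃ s : ℝ, 1 ≤ s ∧ 1 - (α c) ^ 2 = (s : ℂ)) := by
  have hSpos : 0 < S := by
    obtain ⟨q, hq⟩ := Function.ne_iff.mp hg
    rw [hS]
    exact Finset.sum_pos' (fun i _ => sq_nonneg (g i))
      ⟨q, Finset.mem_univ q, (sq_nonneg (g q)).lt_of_ne' (pow_ne_zero 2 hq)⟩
  obtain ⟨k, hk⟩ : ∃ k : ℝ, k = (Real.sqrt (1 + 4 * S) - 1) / (2 * S) := ⟨_, rfl⟩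
  have hkS : k * (1 + k * S) = 1 := by
    have ht : Real.sqrt (1 + 4 * S) ^ 2 = 1 + 4 * S := Real.sq_sqrt (by positivity)
    rw [hk]
    field_simp
    linear_combination ht
  have hα' : ∀ c, α c = -I * ((k * g c : ℝ) : ℂ) := by
    intro c
    have hSne : (S : ℂ) ≠ 0 := ofReal_ne_zero.mpr hSpos.ne'
    rw [hα c, hk]
    push_cast
    field_simp
    rw [I_sq]
    ring
  have hsum : ∑ q, (g q : ℂ) * α q = -I * ((k * S : ℝ) : ℂ) := by
    rw [hS, Finset.mul_sum]
    push_cast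
    rw [Finset.mul_sum]
    refine Finset.sum_congr rfl fun q _ => ?_
    rw [hα' q]
    push_cast
    ring
  have hsq : ∀ c, α c ^ 2 = ((-(k * g c) ^ 2 : ℝ) : ℂ) := by
    intro c
    rw [hα' c, mul_pow, neg_sq, I_sq]
    push_cast
    ring
  refine ⟨fun c => ?_, fun c => ⟨_, neg_nonpos.mpr (sq_nonneg _), hsq c⟩,
    fun c => ⟨1 + (k * g c) ^ 2, le_add_of_nonneg_right (sq_nonneg _), ?_⟩⟩
  · have hkS' : (k : ℂ) * (1 + k * S) = 1 := mod_cast hkS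
    rw [hsum, hα' c]
    push_cast
    linear_combination (-I * (g c : ℂ)) * hkS' + I * (g c : ℂ) * k ^ 2 * S * I_sq
  · rw [hsq c]
    push_cast
    ring
end

section
/- Let c be a nonzero complex number, x(z) := (1/c)(z + 1/z) and x′(z) := (1/c)(1 − 1/z²). Then for all z₁, z₂ ∈ ℂ \ {0} with z₁ ≠ z₂ and z₁·z₂ ≠ 1: x′(z₁)·x′(z₂) / (x(z₁) − x(z₂))² = 1/(z₁ − z₂)² − 1/(z₁·z₂ − 1)². -/
/-- Pullback of the double-pole kernel by the Joukowsky map: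
`x′(z₁) x′(z₂) / (x(z₁) − x(z₂))² = 1/(z₁ − z₂)² − 1/(z₁ z₂ − 1)²`. -/
theorem joukowsky_pullback_double_pole_kernel
    (c : ℂ) (hc : c ≠ 0) (x x' : ℂ → ℂ)
    (hx : ∀ z, x z = (1 / c) * (z + 1 / z))
    (hx' : ∀ z, x' z = (1 / c) * (1 - 1 / z ^ 2)) :
    ∀ z₁ z₂ : ℂ, z₁ ≠ 0 → z₂ ≠ 0 → z₁ ≠ z₂ → z₁ * z₂ ≠ 1 →
      x' z₁ * x' z₂ / (x z₁ - x z₂) ^ 2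
        = 1 / (z₁ - z₂) ^ 2 - 1 / (z₁ * z₂ - 1) ^ 2 := by
  intro z₁ z₂ h₁ h₂ hne hprod
  have hsub : z₁ - z₂ ≠ 0 := sub_ne_zero.mpr hne
  have hmul : z₁ * z₂ - 1 ≠ 0 := sub_ne_zero.mpr hprod
  have hdiff : x z₁ - x z₂ = (z₁ - z₂) * (z₁ * z₂ - 1) / (c * (z₁ * z₂)) := by
    rw [hx, hx]
    field_simp
    ring
  rw [hdiff, hx', hx']
  field_simp
  ring
end

section
/- Let c be a nonzero complex number; set x(z) := (1/c)(z + 1/z), s(z) := (1/c)(z − 1/z) and x′(z) := (1/c)(1 − 1/z²). Then for all z₁, z₂ ∈ ℂ \ {0, 1, −1} with z₁ ≠ z₂ and z₁·z₂ ≠ 1: [x(z₁)·x(z₂) − s(z₁)·s(z₂) − 4/c²] / [2·s(z₁)·s(z₂)·(x(z₁) − x(z₂))²] · x′(z₁)·x′(z₂) = 1/(z₁·z₂ − 1)². -/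
/-- The GUE planar cylinder function pulled back by the Joukowsky map equals
`1/(z₁ z₂ − 1)²`. -/
theorem gue_cylinder_function_joukowsky_pullback
    (c : ℂ) (hc : c ≠ 0) (x s x' : ℂ → ℂ)
    (hx : ∀ z, x z = (1 / c) * (z + 1 / z))
    (hs : ∀ z, s z = (1 / c) * (z - 1 / z))
    (hx' : ∀ z, x' z = (1 / c) * (1 - 1 / z ^ 2)) :
    ∀ z₁ z₂ : ℂ, z₁ ≠ 0 → z₁ ≠ 1 → z₁ ≠ -1 → z₂ ≠ 0 → z₂ ≠ 1 → z₂ ≠ -1 →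
      z₁ ≠ z₂ → z₁ * z₂ ≠ 1 →
      (x z₁ * x z₂ - s z₁ * s z₂ - 4 / c ^ 2) /
          (2 * s z₁ * s z₂ * (x z₁ - x z₂) ^ 2) * x' z₁ * x' z₂
        = 1 / (z₁ * z₂ - 1) ^ 2 := by
  intro z₁ z₂ h₁ h₁' h₁'' h₂ h₂' h₂'' hne hmul
  have s_ne : ∀ z : ℂ, z ≠ 0 → z ≠ 1 → z ≠ -1 → s z ≠ 0 := by
    intro z h0 h1 hm1
    have e : s z = (z - 1) * (z + 1) / (c * z) := by
      rw [hs]; field_simp; ring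
    rw [e]
    exact div_ne_zero (mul_ne_zero (sub_ne_zero.2 h1) fun h => hm1 (eq_neg_of_add_eq_zero_left h))
      (mul_ne_zero hc h0)
  have x'_eq : ∀ z : ℂ, z ≠ 0 → x' z = s z / z := by
    intro z h0
    rw [hx', hs]; field_simp
  have num : x z₁ * x z₂ - s z₁ * s z₂ - 4 / c ^ 2 = 2 * (z₁ - z₂) ^ 2 / (c ^ 2 * (z₁ * z₂)) := by
    rw [hx, hx, hs, hs]; field_simp; ring
  have x_sub : x z₁ - x z₂ = (z₁ - z₂) * (z₁ * z₂ - 1) / (c * (z₁ * z₂)) := by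
    rw [hx, hx]; field_simp; ring
  have hs₁ := s_ne z₁ h₁ h₁' h₁''
  have hs₂ := s_ne z₂ h₂ h₂' h₂''
  have hd : z₁ - z₂ ≠ 0 := sub_ne_zero.2 hne
  have hm : z₁ * z₂ - 1 ≠ 0 := sub_ne_zero.2 hmul
  rw [num, x_sub, x'_eq z₁ h₁, x'_eq z₂ h₂]
  field_simp
end

section
/- Let c be a nonzero complex number, t := c², and η ∈ ℂ. Set x(z) := (1/c)(z + 1/z), s(z) := (1/c)(z − 1/z), x′(z) := (1/c)(1 − 1/z²), and for z₁, z₂ ∈ ℂ \ {0, 1, −1} with z₁ ≠ z₂ and z₁·z₂ ≠ 1 define W₂(z₁,z₂) := [x(z₁)x(z₂) − s(z₁)s(z₂) − 4/t] / [2 s(z₁) s(z₂) (x(z₁) − x(z₂))²] − (η/t)·(c/z₁)·(c/z₂) / (s(z₁)·s(z₂)). Then [W₂(z₁,z₂) + 1/(x(z₁) − x(z₂))²] · x′(z₁)·x′(z₂) = 1/(z₁ − z₂)² − η/(z₁²·z₂²). -/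
/-- The planar monocolored cylinder function of the fluctuation matrix model, pulled back
by the Joukowsky map and corrected by the double-pole kernel, equals
`1/(z₁ − z₂)² − η/(z₁² z₂²)` (equation (34) of the paper). -/
theorem monocolored_cylinder_differential
    (c η : ℂ) (hc : c ≠ 0) (t : ℂ) (ht : t = c ^ 2)
    (x s x' : ℂ → ℂ)
    (hx : ∀ z, x z = (1 / c) * (z + 1 / z))
    (hs : ∀ z, s z = (1 / c) * (z - 1 / z))
    (hx' : ∀ z, x' z = (1 / c) * (1 - 1 / z ^ 2))
    (z₁ z₂ : ℂ) (hz₁ : z₁ ≠ 0) (hz₁1 : z₁ ≠ 1) (hz₁m : z₁ ≠ -1)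
    (hz₂ : z₂ ≠ 0) (hz₂1 : z₂ ≠ 1) (hz₂m : z₂ ≠ -1)
    (hne : z₁ ≠ z₂) (hprod : z₁ * z₂ ≠ 1)
    (W₂ : ℂ)
    (hW₂ : W₂ = (x z₁ * x z₂ - s z₁ * s z₂ - 4 / t) /
        (2 * s z₁ * s z₂ * (x z₁ - x z₂) ^ 2)
      - (η / t) * (c / z₁) * (c / z₂) / (s z₁ * s z₂)) :
    (W₂ + 1 / (x z₁ - x z₂) ^ 2) * x' z₁ * x' z₂
      = 1 / (z₁ - z₂) ^ 2 - η / (z₁ ^ 2 * z₂ ^ 2) := by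
  have h₁ : z₁ ^ 2 - 1 ≠ 0 := sub_ne_zero.mpr (sq_ne_one_iff.mpr ⟨hz₁1, hz₁m⟩)
  have h₂ : z₂ ^ 2 - 1 ≠ 0 := sub_ne_zero.mpr (sq_ne_one_iff.mpr ⟨hz₂1, hz₂m⟩)
  have hd : z₁ - z₂ ≠ 0 := sub_ne_zero.mpr hne
  have hp : z₁ * z₂ - 1 ≠ 0 := sub_ne_zero.mpr hprod
  have hs₁ : s z₁ = (z₁ ^ 2 - 1) / (c * z₁) := by rw [hs]; field_simp
  have hs₂ : s z₂ = (z₂ ^ 2 - 1) / (c * z₂) := by rw [hs]; field_simp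
  have hx'₁ : x' z₁ = (z₁ ^ 2 - 1) / (c * z₁ ^ 2) := by rw [hx']; field_simp
  have hx'₂ : x' z₂ = (z₂ ^ 2 - 1) / (c * z₂ ^ 2) := by rw [hx']; field_simp
  have hxsub : x z₁ - x z₂ = (z₁ - z₂) * (z₁ * z₂ - 1) / (c * z₁ * z₂) := by
    rw [hx, hx]; field_simp; ring
  rw [hW₂, hxsub, hs₁, hs₂, hx'₁, hx'₂, hx, hx, ht]
  field_simp
  ring
end

section
/- Let d ≥ 2, fix j ∈ {1,…,d}, and let α₁,…,α_d, D, w₁,…,w_d be complex numbers satisfying the linear system: −(1 − α_j²)·w_j + Σ_{p ≠ j} α_j α_p w_p = D, and for every i ≠ j: −(1 − α_i²)·w_i + Σ_{p ≠ i} α_i α_p w_p = 0. If Σ_{p=1}^d α_p² ≠ 1, then the solution is unique and given by w_i = α_i·α_j·D / (Σ_p α_p² − 1) for every i ≠ j, and w_j = D·(1 − Σ_{p ≠ j} α_p²) / (Σ_p α_p² − 1). -/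
/-- Unique solution of the linear system (equation (16) of the paper) satisfied by the
second coefficients of the planar cylinder functions of the fluctuation matrix model. -/
theorem cylinder_coefficients_linear_system_solution
    (d : ℕ) (hd : 2 ≤ d) (j : Fin d) (α w : Fin d → ℂ) (D : ℂ)
    (hj : -(1 - α j ^ 2) * w j + ∑ p ∈ Finset.univ.erase j, α j * α p * w p = D)
    (hi : ∀ i, i ≠ j →
      -(1 - α i ^ 2) * w i + ∑ p ∈ Finset.univ.erase i, α i * α p * w p = 0)
    (hS : ∑ p, (α p) ^ 2 ≠ 1) :
    (∀ i, i ≠ j → w i = α i * α j * D / (∑ p, (α p) ^ 2 - 1)) ∧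
    w j = D * (1 - ∑ p ∈ Finset.univ.erase j, (α p) ^ 2) / (∑ p, (α p) ^ 2 - 1) := by
  have split (i : Fin d) (f : Fin d → ℂ) : ∑ p, f p = f i + ∑ p ∈ Finset.univ.erase i, f p :=
    (Finset.add_sum_erase _ f (Finset.mem_univ i)).symm
  have row (i : Fin d) : -(1 - α i ^ 2) * w i + ∑ p ∈ Finset.univ.erase i, α i * α p * w p
      = α i * ∑ p, α p * w p - w i := by
    rw [split i]
    simp only [mul_assoc, ← Finset.mul_sum]
    ring
  rw [row] at hj
  have hw : ∀ i, i ≠ j → w i = α i * ∑ p, α p * w p := fun i hij => by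
    linear_combination row i - hi i hij
  have hsum : ∑ p ∈ Finset.univ.erase j, α p * w p
      = (∑ p ∈ Finset.univ.erase j, α p ^ 2) * ∑ p, α p * w p := by
    rw [Finset.sum_mul]
    refine Finset.sum_congr rfl fun p hp => ?_
    linear_combination α p * hw p (Finset.ne_of_mem_erase hp)
  have hT := split j fun p => α p * w p
  have hα := split j fun p => α p ^ 2
  rw [hsum] at hT
  have hS' : ∑ p, α p ^ 2 - 1 ≠ 0 := sub_ne_zero.mpr hS
  generalize ∑ p, α p * w p = T at *
  have hTD : T * (∑ p, α p ^ 2 - 1) = α j * D := by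
    linear_combination T * hα - hT + α j * hj
  refine ⟨fun i hij => ?_, ?_⟩
  · rw [eq_div_iff hS']
    linear_combination (∑ p, α p ^ 2 - 1) * hw i hij + α i * hTD
  · rw [eq_div_iff hS']
    linear_combination α j * hTD - (∑ p, α p ^ 2 - 1) * hj - D * hα
end

section
/- Let d ≥ 2, fix j ∈ {1,…,d}, and let α₁,…,α_d, D, w₁,…,w_d be complex numbers satisfying: −(1 − α_j²)·w_j + Σ_{p ≠ j} α_j α_p w_p = D, and for every i ≠ j: −(1 − α_i²)·w_i + Σ_{p ≠ i} α_i α_p w_p = 0. Define Q := Σ_{p ≠ j} α_j α_p w_p, and for i ≠ j let F_i := Σ_{p ≠ i} α_i α_p w_p. Then (i) Q · (1 − Σ_{p ≠ j} α_p²) = w_j · Σ_{p ≠ j} (α_p α_j)², and (ii) for every i ≠ j: F_i · Σ_{p ≠ j} (α_p α_j)² = (1 − α_i²) · α_i α_j · Q. -/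
/-- The quantities `Q_j` and `F_j^{(i)}` built from a solution of the cylinder linear
system satisfy the cross-multiplied relations (17) and (19) of the paper. -/
theorem cylinder_Q_and_F_relations
    (d : ℕ) (hd : 2 ≤ d) (j : Fin d) (α w : Fin d → ℂ) (D : ℂ)
    (hj : -(1 - α j ^ 2) * w j + ∑ p ∈ Finset.univ.erase j, α j * α p * w p = D)
    (hi : ∀ i, i ≠ j →
      -(1 - α i ^ 2) * w i + ∑ p ∈ Finset.univ.erase i, α i * α p * w p = 0)
    (Q : ℂ) (hQ : Q = ∑ p ∈ Finset.univ.erase j, α j * α p * w p)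
    (F : Fin d → ℂ)
    (hF : ∀ i, i ≠ j → F i = ∑ p ∈ Finset.univ.erase i, α i * α p * w p) :
    Q * (1 - ∑ p ∈ Finset.univ.erase j, (α p) ^ 2)
      = w j * ∑ p ∈ Finset.univ.erase j, (α p * α j) ^ 2 ∧
    (∀ i, i ≠ j → F i * ∑ p ∈ Finset.univ.erase j, (α p * α j) ^ 2
      = (1 - α i ^ 2) * α i * α j * Q) := by
  have sum_erase (i : Fin d) : ∑ p ∈ Finset.univ.erase i, α i * α p * w p
      = α i * (∑ p, α p * w p - α i * w i) := by
    rw [← Finset.add_sum_erase Finset.univ (fun p => α p * w p) (Finset.mem_univ i),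
      add_sub_cancel_left, Finset.mul_sum]
    simp only [mul_assoc]
  have sum_sq : ∑ p ∈ Finset.univ.erase j, (α p * α j) ^ 2
      = (∑ p ∈ Finset.univ.erase j, α p ^ 2) * α j ^ 2 := by
    simp only [mul_pow, Finset.sum_mul]
  have hw : ∀ i, i ≠ j → w i = α i * ∑ p, α p * w p := by
    intro i hij
    have h := hi i hij
    rw [sum_erase] at h
    linear_combination -h
  have hS : ∑ p, α p * w p
      = α j * w j + (∑ p ∈ Finset.univ.erase j, α p ^ 2) * ∑ p, α p * w p := by
    rw [Finset.sum_mul]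
    conv_lhs => rw [← Finset.add_sum_erase Finset.univ _ (Finset.mem_univ j)]
    congr 1
    refine Finset.sum_congr rfl fun p hp => ?_
    linear_combination α p * hw p (Finset.ne_of_mem_erase hp)
  rw [sum_erase] at hQ
  rw [sum_sq]
  set S := ∑ p, α p * w p
  set T := ∑ p ∈ Finset.univ.erase j, α p ^ 2
  have hQS : Q = α j * (T * S) := by linear_combination hQ + α j * hS
  refine ⟨by linear_combination (1 - T) * hQS + α j * T * hS, fun i hij => ?_⟩
  have hFi := hF i hij
  rw [sum_erase] at hFi
  linear_combination T * α j ^ 2 * hFi - T * α j ^ 2 * α i ^ 2 * hw i hij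
    - (1 - α i ^ 2) * α i * α j * hQS
end

section
/- Let t > 0 be a real number. For x > 2/√t set σ(x) := √(x² − 4/t) (real square root) and W(x) := (t/2)·(x − σ(x)). For x₁, x₂ > 2/√t with x₁ ≠ x₂ define W₂(x₁,x₂) := (x₁x₂ − σ(x₁)σ(x₂) − 4/t) / (2·σ(x₁)·σ(x₂)·(x₁ − x₂)²). Then for all such x₁ ≠ x₂: (2·W(x₁) − t·x₁)·W₂(x₁,x₂) + D = 0, where D is the derivative at y = x₂ of the function y ↦ (W(x₁) − W(y))/(x₁ − y) (in the sense of HasDerivAt). -/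
/-- Outside the cut, the quantity under the square root is positive. -/
lemma sq_sub_four_div_pos {t x : ℝ} (ht : 0 < t) (hx : 2 / Real.sqrt t < x) :
    0 < x ^ 2 - 4 / t := by
  have h : (2 / Real.sqrt t) ^ 2 < x ^ 2 := by
    gcongr
  rw [div_pow, Real.sq_sqrt ht.le] at h
  linarith

lemma hasDerivAt_sqrt_sq_sub {c x : ℝ} (hx : 0 < x ^ 2 - c) :
    HasDerivAt (fun y => Real.sqrt (y ^ 2 - c)) (x / Real.sqrt (x ^ 2 - c)) x := by
  have h := (((hasDerivAt_id x).pow 2).sub_const c).sqrt hx.ne'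
  refine h.congr_deriv ?_
  have : Real.sqrt (x ^ 2 - c) ≠ 0 := (Real.sqrt_pos.2 hx).ne'
  simp only [Pi.pow_apply, id]
  field_simp
  norm_num

/-- The GUE planar cylinder function `W₂` satisfies the planar cylinder loop equation
`(2W(x₁) − t x₁) W₂(x₁,x₂) + ∂_{x₂}[(W(x₁) − W(x₂))/(x₁ − x₂)] = 0`. -/
theorem gue_cylinder_loop_equation
    (t : ℝ) (ht : 0 < t) (σ W : ℝ → ℝ)
    (hσ : ∀ x, 2 / Real.sqrt t < x → σ x = Real.sqrt (x ^ 2 - 4 / t))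
    (hW : ∀ x, 2 / Real.sqrt t < x → W x = (t / 2) * (x - σ x))
    (W₂ : ℝ → ℝ → ℝ)
    (hW₂ : ∀ x₁ x₂, 2 / Real.sqrt t < x₁ → 2 / Real.sqrt t < x₂ → x₁ ≠ x₂ →
      W₂ x₁ x₂ = (x₁ * x₂ - σ x₁ * σ x₂ - 4 / t) /
        (2 * σ x₁ * σ x₂ * (x₁ - x₂) ^ 2)) :
    ∀ x₁ x₂, 2 / Real.sqrt t < x₁ → 2 / Real.sqrt t < x₂ → x₁ ≠ x₂ →
      ∃ D : ℝ, HasDerivAt (fun y => (W x₁ - W y) / (x₁ - y)) D x₂ ∧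
        (2 * W x₁ - t * x₁) * W₂ x₁ x₂ + D = 0 := by
  intro x₁ x₂ h₁ h₂ hne
  have hpos₁ := sq_sub_four_div_pos ht h₁
  have hpos₂ := sq_sub_four_div_pos ht h₂
  have hs₁ : σ x₁ ≠ 0 := by
    rw [hσ x₁ h₁]; exact (Real.sqrt_pos.2 hpos₁).ne'
  have hs₂ : σ x₂ ≠ 0 := by
    rw [hσ x₂ h₂]; exact (Real.sqrt_pos.2 hpos₂).ne'
  have hsq₂ : σ x₂ ^ 2 = x₂ ^ 2 - 4 / t := by
    rw [hσ x₂ h₂, Real.sq_sqrt hpos₂.le]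
  have hd : x₁ - x₂ ≠ 0 := sub_ne_zero.2 hne
  have hW' : HasDerivAt W (t / 2 * (1 - x₂ / σ x₂)) x₂ := by
    rw [hσ x₂ h₂]
    refine (((hasDerivAt_id x₂).sub (hasDerivAt_sqrt_sq_sub hpos₂)).const_mul
      (t / 2)).congr_of_eventuallyEq ?_
    filter_upwards [lt_mem_nhds h₂] with y hy
    simp [hW y hy, hσ y hy]
  refine ⟨_, (hW'.const_sub (W x₁)).div ((hasDerivAt_id x₂).const_sub x₁) hd, ?_⟩
  rw [hW₂ x₁ x₂ h₁ h₂ hne, hW x₁ h₁, hW x₂ h₂]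
  have hc : 4 / t = x₂ ^ 2 - σ x₂ ^ 2 := by linarith
  rw [hc]
  field_simp
  ring
end

section
/- Let c be a nonzero complex number, t := c², and let α be a complex number with t = 1 − α² and 1 − 3α² ≠ 0. For z ∈ ℂ \ {0, 1, −1} set x := (1/c)(z + 1/z), s := (1/c)(z − 1/z), W := c/z, x′ := (1/c)(1 − 1/z²), and W½ := (α³/(t·s))·( x·(x·W − 1) + (2/(t·(1 − 3α²)))·W ). Then W½ · x′ = (α³/(t·c)) · ( 1/z² + 3t/(1 − 3α²) ) · (1/z²). In particular W½·x′ extends holomorphically across z = 1 and z = −1 (it has no poles there, only poles at z = 0). -/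
/-- In Joukowsky coordinates, the order-`1/√N` correction differential at `d = 3` is
`W^{1/2}(x(z)) x′(z) = (α³/(t c)) (1/z² + 3t/(1 − 3α²)) / z²`; in particular it has no
poles at `z = ±1`, only at `z = 0`. -/
theorem first_correction_differential_no_branch_poles
    (c t α : ℂ) (hc : c ≠ 0) (ht : t = c ^ 2) (htα : t = 1 - α ^ 2)
    (h3 : 1 - 3 * α ^ 2 ≠ 0) :
    (∀ z : ℂ, z ≠ 0 → z ≠ 1 → z ≠ -1 →
      ((α ^ 3 / (t * ((1 / c) * (z - 1 / z)))) *
          (((1 / c) * (z + 1 / z)) * (((1 / c) * (z + 1 / z)) * (c / z) - 1)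
            + (2 / (t * (1 - 3 * α ^ 2))) * (c / z)))
        * ((1 / c) * (1 - 1 / z ^ 2))
      = (α ^ 3 / (t * c)) * (1 / z ^ 2 + 3 * t / (1 - 3 * α ^ 2)) * (1 / z ^ 2)) ∧
    AnalyticAt ℂ
      (fun z : ℂ => (α ^ 3 / (t * c)) * (1 / z ^ 2 + 3 * t / (1 - 3 * α ^ 2)) * (1 / z ^ 2))
      1 ∧
    AnalyticAt ℂ
      (fun z : ℂ => (α ^ 3 / (t * c)) * (1 / z ^ 2 + 3 * t / (1 - 3 * α ^ 2)) * (1 / z ^ 2))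
      (-1) := by
  refine ⟨fun z hz hz1 hz2 => ?_, ?_, ?_⟩
  · have hD : 3 * t = (1 - 3 * α ^ 2) + 2 := by rw [htα]; ring
    rw [hD]
    generalize 1 - 3 * α ^ 2 = D at h3
    subst ht
    have hz3 : z ^ 2 - 1 ≠ 0 := by
      rw [show z ^ 2 - 1 = (z - 1) * (z + 1) by ring]
      exact mul_ne_zero (sub_ne_zero.mpr hz1) fun h => hz2 (eq_neg_of_add_eq_zero_left h)
    have hs : z - 1 / z = (z ^ 2 - 1) / z := by field_simp
    have hx : 1 - 1 / z ^ 2 = (z ^ 2 - 1) / z ^ 2 := by field_simp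
    rw [hs, hx]
    field_simp
    ring
  all_goals fun_prop (disch := norm_num)
end
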